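/- Let r ≥ 2, k ≥ 2, s ≥ 1 and n ≥ s + r. Then the number of sunflower copies in the star satisfies the exact formula N(S_{r-1,k}^r, K(n,r,s)) = Σ_{j=0}^{r-2} C(s-1, r-1-j)·C(n-s+1, j)·C(n-r+1, k) + C(n-s+1, r-1)·C(s-1, k), where C(a,b) denotes the binomial coefficient (with C(a,b) = 0 when a < b). -/

import Mathlib

open Finset

open scoped Classical

/-- `H` is an `r`-graph on the vertex set `[n] = {1, …, n}`. -/
def IsRGraph (n r : ℕ) (H : Finset (Finset ℕ)) : Prop :=
  ∀ e ∈ H, e ⊆ Finset.Icc 1 n ∧ e.card = r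

/-- The number of copies of the sunflower with `k` petals and core of size `t` in `H`:
families of `k` distinct hyperedges of `H` whose pairwise intersections all equal
a common `t`-element set. -/
noncomputable def sunCount (t k : ℕ) (H : Finset (Finset ℕ)) : ℕ :=
  ((H.powersetCard k).filter fun F => ∃ T : Finset ℕ, T.card = t ∧
    ∀ e ∈ F, ∀ f ∈ F, e ≠ f → e ∩ f = T).card

/-- The star `K(n,r,s)`: all `r`-subsets of `[n]` meeting `[s-1]`. -/
def starGraph (n r s : ℕ) : Finset (Finset ℕ) :=
  ((Finset.Icc 1 n).powersetCard r).filter fun e => (e ∩ Finset.Icc 1 (s - 1)).Nonempty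

/-- `H` contains a matching of size `s`, i.e. `s` pairwise disjoint hyperedges. -/
def HasMatching (H : Finset (Finset ℕ)) (s : ℕ) : Prop :=
  ∃ M ⊆ H, M.card = s ∧ ∀ e ∈ M, ∀ f ∈ M, e ≠ f → Disjoint e f

/-- The shifting operator `S_{ij}` applied to a hyperedge `e` of `H`. -/
def shiftEdge (H : Finset (Finset ℕ)) (i j : ℕ) (e : Finset ℕ) : Finset ℕ :=
  if j ∈ e ∧ i ∉ e ∧ insert i (e.erase j) ∉ H then insert i (e.erase j) else e

/-- The shifted hypergraph `S_{ij}(H)`. -/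
def shift (H : Finset (Finset ℕ)) (i j : ℕ) : Finset (Finset ℕ) :=
  H.image (shiftEdge H i j)

/-- `H` is shifted (stable): `S_{ij}(H) = H` for all `1 ≤ i < j ≤ n`. -/
def IsShifted (n : ℕ) (H : Finset (Finset ℕ)) : Prop :=
  ∀ i j : ℕ, 1 ≤ i → i < j → j ≤ n → shift H i j = H

/-- `H − {i}`: the hyperedges of `H` avoiding the vertex `i`. -/
def deleteVertex (H : Finset (Finset ℕ)) (i : ℕ) : Finset (Finset ℕ) :=
  H.filter fun e => i ∉ e

/-- The link `L_i(H)` of the vertex `i`. -/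
def link (H : Finset (Finset ℕ)) (i : ℕ) : Finset (Finset ℕ) :=
  (H.filter fun e => i ∈ e).image fun e => e.erase i

/-- The degree `d_H(T)`: the number of hyperedges of `H` containing `T`. -/
def degreeOf (H : Finset (Finset ℕ)) (T : Finset ℕ) : ℕ :=
  (H.filter fun e => T ⊆ e).card

/-- The `(t,k)`-norm of `H` on the vertex set `[n]`. -/
def normTK (n t k : ℕ) (H : Finset (Finset ℕ)) : ℕ :=
  ∑ T ∈ (Finset.Icc 1 n).powersetCard t, (degreeOf H T) ^ k

/-- Two distinct `r`-sets containing a common `(r-1)`-set meet exactly in that set. -/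
lemma inter_eq_of_subset_of_card {r : ℕ} {T e f : Finset ℕ} (hr : 1 ≤ r) (hT : T.card = r - 1)
    (he : e.card = r) (hf : f.card = r) (hne : e ≠ f) (hTe : T ⊆ e) (hTf : T ⊆ f) :
    e ∩ f = T := by
  refine (Finset.eq_of_subset_of_card_le (Finset.subset_inter hTe hTf) ?_).symm
  have hlt : (e ∩ f).card < e.card := by
    refine Finset.card_lt_card (Finset.inter_subset_left.ssubset_of_ne fun h => hne ?_)
    exact Finset.eq_of_subset_of_card_le (Finset.inter_eq_left.mp h) (by omega)
  omega

/-- Sunflowers with core of size `r - 1` in an `r`-graph are counted by their cores. -/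
lemma sunCount_eq_sum_choose_degreeOf {n r k : ℕ} (hr : 1 ≤ r) (hk : 2 ≤ k)
    {H : Finset (Finset ℕ)} (hH : IsRGraph n r H) :
    sunCount (r - 1) k H =
      ∑ T ∈ (Finset.Icc 1 n).powersetCard (r - 1), (degreeOf H T).choose k := by
  have key : ((H.powersetCard k).filter fun F => ∃ T : Finset ℕ, T.card = r - 1 ∧
      ∀ e ∈ F, ∀ f ∈ F, e ≠ f → e ∩ f = T) =
      ((Finset.Icc 1 n).powersetCard (r - 1)).biUnion
        fun T => (H.filter fun e => T ⊆ e).powersetCard k := by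
    ext F
    simp only [Finset.mem_filter, Finset.mem_biUnion, Finset.mem_powersetCard]
    constructor
    · rintro ⟨⟨hFH, hFk⟩, T, hT, h⟩
      have hsub : ∀ e ∈ F, T ⊆ e := fun e he => by
        obtain ⟨f, hf, hne⟩ := Finset.exists_mem_ne (by omega : 1 < F.card) e
        rw [← h e he f hf hne.symm]
        exact Finset.inter_subset_left
      obtain ⟨e, he⟩ : F.Nonempty := Finset.card_pos.mp (by omega)
      exact ⟨T, ⟨(hsub e he).trans (hH e (hFH he)).1, hT⟩,
        fun f hf => Finset.mem_filter.mpr ⟨hFH hf, hsub f hf⟩, hFk⟩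
    · rintro ⟨T, ⟨-, hT⟩, hF, hFk⟩
      have hF' := fun e (he : e ∈ F) => Finset.mem_filter.mp (hF he)
      exact ⟨⟨fun e he => (hF' e he).1, hFk⟩, T, hT, fun e he f hf hne =>
        inter_eq_of_subset_of_card hr hT (hH e (hF' e he).1).2 (hH f (hF' f hf).1).2 hne
          (hF' e he).2 (hF' f hf).2⟩
  rw [sunCount, key, Finset.card_biUnion]
  · simp only [Finset.card_powersetCard, degreeOf]
  · intro T hT T' hT' hne
    rw [Function.onFun, Finset.disjoint_left]
    intro F hF hF'
    rw [Finset.mem_coe, Finset.mem_powersetCard] at hT hT'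
    rw [Finset.mem_powersetCard] at hF hF'
    obtain ⟨e, he, f, hf, hef⟩ := Finset.one_lt_card.mp (by omega : 1 < F.card)
    have h₁ := fun e (he : e ∈ F) => Finset.mem_filter.mp (hF.1 he)
    have h₂ := fun e (he : e ∈ F) => Finset.mem_filter.mp (hF'.1 he)
    have hce := (hH e (h₁ e he).1).2
    have hcf := (hH f (h₁ f hf).1).2
    exact hne <|
      (inter_eq_of_subset_of_card hr hT.2 hce hcf hef (h₁ e he).2 (h₁ f hf).2).symm.trans
        (inter_eq_of_subset_of_card hr hT'.2 hce hcf hef (h₂ e he).2 (h₂ f hf).2)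

/-- The degree in a star of an `(r-1)`-set `T` counts the vertices extending `T` to a hyperedge. -/
lemma degreeOf_starGraph {n r s : ℕ} (hr : 1 ≤ r) {T : Finset ℕ}
    (hT : T ∈ (Finset.Icc 1 n).powersetCard (r - 1)) :
    degreeOf (starGraph n r s) T = ((Finset.Icc 1 n \ T).filter fun x =>
      (insert x T ∩ Finset.Icc 1 (s - 1)).Nonempty).card := by
  rw [Finset.mem_powersetCard] at hT
  symm
  refine Finset.card_bij (fun x _ => insert x T) ?_ ?_ ?_
  · intro x hx
    simp only [Finset.mem_filter, Finset.mem_sdiff] at hx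
    simp only [starGraph, Finset.mem_filter, Finset.mem_powersetCard]
    refine ⟨⟨⟨Finset.insert_subset hx.1.1 hT.1, ?_⟩, hx.2⟩, Finset.subset_insert x T⟩
    rw [Finset.card_insert_of_notMem hx.1.2]
    omega
  · intro x hx y hy hxy
    simp only [Finset.mem_filter, Finset.mem_sdiff] at hx
    exact (Finset.mem_insert.mp (hxy ▸ Finset.mem_insert_self x T)).resolve_right hx.1.2
  · intro e he
    simp only [starGraph, Finset.mem_filter, Finset.mem_powersetCard] at he
    obtain ⟨⟨⟨heV, hec⟩, hes⟩, hTe⟩ := he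
    obtain ⟨x, hx⟩ : ∃ x, e \ T = {x} := Finset.card_eq_one.mp (by
      rw [Finset.card_sdiff_of_subset hTe]; omega)
    have hins : insert x T = e := by
      rw [Finset.insert_eq, ← hx, Finset.sdiff_union_of_subset hTe]
    have hxe := Finset.mem_sdiff.mp (hx ▸ Finset.mem_singleton_self x : x ∈ e \ T)
    refine ⟨x, ?_, hins⟩
    simp only [Finset.mem_filter, Finset.mem_sdiff]
    exact ⟨⟨heV hxe.1, hxe.2⟩, hins ▸ hes⟩

lemma degreeOf_starGraph_of_nonempty {n r s : ℕ} (hr : 1 ≤ r) (hrn : r ≤ n) {T : Finset ℕ}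
    (hT : T ∈ (Finset.Icc 1 n).powersetCard (r - 1))
    (hTs : (T ∩ Finset.Icc 1 (s - 1)).Nonempty) :
    degreeOf (starGraph n r s) T = n - r + 1 := by
  rw [degreeOf_starGraph hr hT, Finset.filter_true_of_mem]
  · rw [Finset.mem_powersetCard] at hT
    rw [Finset.card_sdiff_of_subset hT.1, Nat.card_Icc, hT.2]
    omega
  · exact fun x _ => hTs.mono
      (Finset.inter_subset_inter_right (Finset.subset_insert x T))

lemma degreeOf_starGraph_of_not_nonempty {n r s : ℕ} (hr : 1 ≤ r) (hsn : s ≤ n)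
    {T : Finset ℕ} (hT : T ∈ (Finset.Icc 1 n).powersetCard (r - 1))
    (hTs : ¬ (T ∩ Finset.Icc 1 (s - 1)).Nonempty) :
    degreeOf (starGraph n r s) T = s - 1 := by
  have h : ((Finset.Icc 1 n \ T).filter fun x =>
      (insert x T ∩ Finset.Icc 1 (s - 1)).Nonempty) = Finset.Icc 1 (s - 1) := by
    rw [Finset.not_nonempty_iff_eq_empty] at hTs
    ext x
    by_cases hx : x ∈ Finset.Icc 1 (s - 1)
    · have hxT : x ∉ T := fun h => by
        have := Finset.mem_inter.mpr ⟨h, hx⟩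
        simp [hTs] at this
      have hxn : x ∈ Finset.Icc 1 n := by
        rw [Finset.mem_Icc] at hx ⊢
        omega
      simp only [Finset.mem_filter, Finset.mem_sdiff, hx, iff_true]
      exact ⟨⟨hxn, hxT⟩, x, Finset.mem_inter.mpr ⟨Finset.mem_insert_self x T, hx⟩⟩
    · simp [Finset.insert_inter_of_notMem hx, hTs, hx]
  rw [degreeOf_starGraph hr hT, h, Nat.card_Icc]
  omega

lemma card_filter_not_nonempty_inter {n m s : ℕ} (hs : 1 ≤ s) (hsn : s ≤ n) :
    (((Finset.Icc 1 n).powersetCard m).filter fun T =>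
      ¬ (T ∩ Finset.Icc 1 (s - 1)).Nonempty).card = (n - s + 1).choose m := by
  have h : (((Finset.Icc 1 n).powersetCard m).filter fun T =>
      ¬ (T ∩ Finset.Icc 1 (s - 1)).Nonempty) =
      (Finset.Icc 1 n \ Finset.Icc 1 (s - 1)).powersetCard m := by
    ext T
    simp only [Finset.mem_filter, Finset.mem_powersetCard, Finset.subset_sdiff,
      Finset.not_nonempty_iff_eq_empty, ← Finset.disjoint_iff_inter_eq_empty]
    tauto
  rw [h, Finset.card_powersetCard, Finset.card_sdiff_of_subset
    (Finset.Icc_subset_Icc_right (by omega)), Nat.card_Icc, Nat.card_Icc]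
  congr 1
  omega

lemma card_filter_nonempty_inter {n m s : ℕ} (hs : 1 ≤ s) (hsn : s ≤ n) :
    (((Finset.Icc 1 n).powersetCard m).filter fun T =>
      (T ∩ Finset.Icc 1 (s - 1)).Nonempty).card =
      ∑ j ∈ Finset.range m, (s - 1).choose (m - j) * (n - s + 1).choose j := by
  have hsplit := Finset.card_filter_add_card_filter_not (s := (Finset.Icc 1 n).powersetCard m)
    (fun T => (T ∩ Finset.Icc 1 (s - 1)).Nonempty)
  rw [card_filter_not_nonempty_inter hs hsn, Finset.card_powersetCard, Nat.card_Icc,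
    show n + 1 - 1 = (n - s + 1) + (s - 1) by omega,
    Nat.add_choose_eq (n - s + 1) (s - 1) m,
    Finset.Nat.sum_antidiagonal_eq_sum_range_succ
      (fun i j => (n - s + 1).choose i * (s - 1).choose j),
    Finset.sum_range_succ, Nat.sub_self, Nat.choose_zero_right, mul_one] at hsplit
  simp only [mul_comm ((s - 1).choose _)]
  exact Nat.add_right_cancel hsplit

theorem sunCount_star_formula (n r k s : ℕ) (hr : 2 ≤ r) (hk : 2 ≤ k) (hs : 1 ≤ s)
    (hn : s + r ≤ n) :
    sunCount (r - 1) k (starGraph n r s) =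
      (∑ j ∈ Finset.range (r - 1),
        Nat.choose (s - 1) (r - 1 - j) * Nat.choose (n - s + 1) j *
          Nat.choose (n - r + 1) k) +
      Nat.choose (n - s + 1) (r - 1) * Nat.choose (s - 1) k := by
  have hH : IsRGraph n r (starGraph n r s) := fun e he =>
    Finset.mem_powersetCard.mp (Finset.mem_filter.mp he).1
  rw [sunCount_eq_sum_choose_degreeOf (by omega) hk hH,
    ← Finset.sum_filter_add_sum_filter_not _
      (fun T => (T ∩ Finset.Icc 1 (s - 1)).Nonempty), ← Finset.sum_mul,
    ← card_filter_nonempty_inter hs (by omega), ← card_filter_not_nonempty_inter hs (by omega)]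
  congr 1
  · refine Finset.sum_const_nat fun T hT => ?_
    rw [Finset.mem_filter] at hT
    rw [degreeOf_starGraph_of_nonempty (by omega) (by omega) hT.1 hT.2]
  · refine Finset.sum_const_nat fun T hT => ?_
    rw [Finset.mem_filter] at hT
    rw [degreeOf_starGraph_of_not_nonempty (by omega) (by omega) hT.1 hT.2]
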